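/- arXiv:1910.03718 — 4 statements merged into one kernel-verified Lean document; each statement's English description precedes it below -/
import Mathlib

section
/- Partial super-additivity of the diagonal embedding (Proposition 1, eq. (12)): let {Ω_1, …, Ω_I} be a partition of {1, …, K}, and let B_1, …, B_K and A'_1, …, A'_K be m×n complex matrices such that Σ_{k∈Ω_i} μ(B_k) ≤ μ(Σ_{k∈Ω_i} A'_k) for every i. Then for every real θ ≥ 0, Σ_{k=1}^K log(θ·μ(B_k) + 1) ≤ Σ_{i=1}^I |Ω_i| · log(θ·μ((1/|Ω_i|)·Σ_{k∈Ω_i} A'_k) + 1). -/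
open Finset

/-- Partial super-additivity of the diagonal embedding (Proposition 1, eq. (12)). -/
theorem diag_embedding_partial_superadditive
    (m n : ℕ) (hm : 0 < m) (hn : 0 < n)
    (μ : Matrix (Fin m) (Fin n) ℂ → ℝ)
    (hC1 : ∀ A, 0 ≤ μ A)
    (hC2 : ∀ (θ : ℝ), 0 ≤ θ → ∀ A, μ (θ • A) = θ * μ A)
    (hC3 : ∀ A B, μ (A + B) ≤ μ A + μ B)
    (K : ℕ) (hK : 0 < K)
    (I : ℕ) (Part : Fin I → Finset (Fin K))
    (hne : ∀ i, (Part i).Nonempty)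
    (hdisj : ∀ i j, i ≠ j → Disjoint (Part i) (Part j))
    (hcover : ∀ k, ∃ i, k ∈ Part i)
    (B A' : Fin K → Matrix (Fin m) (Fin n) ℂ)
    (hBA : ∀ i, ∑ k ∈ Part i, μ (B k) ≤ μ (∑ k ∈ Part i, A' k))
    (θ : ℝ) (hθ : 0 ≤ θ) :
    ∑ k, Real.log (θ * μ (B k) + 1) ≤
      ∑ i, ((Part i).card : ℝ) *
        Real.log (θ * μ ((((Part i).card : ℝ))⁻¹ • ∑ k ∈ Part i, A' k) + 1) := by
  have huniv : (Finset.univ : Finset (Fin K)) = Finset.univ.biUnion Part := by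
    ext k
    simpa using hcover k
  rw [huniv, Finset.sum_biUnion (fun i _ j _ hij => hdisj i j hij)]
  refine Finset.sum_le_sum fun i _ => ?_
  have hc : (0 : ℝ) < ((Part i).card : ℝ) := by exact_mod_cast (hne i).card_pos
  rw [hC2 _ (inv_nonneg.2 hc.le)]
  have hM := hC1 (∑ k ∈ Part i, A' k)
  have hB := hBA i
  generalize μ (∑ k ∈ Part i, A' k) = M at hM hB ⊢
  have hy : 0 < θ * (((Part i).card : ℝ)⁻¹ * M) + 1 := by positivity
  have hcy : ((Part i).card : ℝ) * (θ * (((Part i).card : ℝ)⁻¹ * M) + 1)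
      = θ * M + (Part i).card := by field_simp
  generalize θ * (((Part i).card : ℝ)⁻¹ * M) + 1 = y at hy hcy ⊢
  have key : ∀ k ∈ Part i, Real.log (θ * μ (B k) + 1) ≤
      Real.log y + ((θ * μ (B k) + 1) / y - 1) := by
    intro k _
    have hx : 0 < θ * μ (B k) + 1 := by
      have := mul_nonneg hθ (hC1 (B k))
      linarith
    have h := Real.log_le_sub_one_of_pos (div_pos hx hy)
    rw [Real.log_div hx.ne' hy.ne'] at h
    linarith
  refine (Finset.sum_le_sum key).trans ?_
  have hs : (∑ k ∈ Part i, (θ * μ (B k) + 1)) / y ≤ (Part i).card := by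
    rw [div_le_iff₀ hy, hcy, Finset.sum_add_distrib, ← Finset.mul_sum]
    have := mul_le_mul_of_nonneg_left hB hθ
    simpa using this
  rw [Finset.sum_add_distrib, Finset.sum_sub_distrib, ← Finset.sum_div]
  simp only [Finset.sum_const, nsmul_eq_mul, mul_one]
  linarith
end

section
/- Scalar inequality used in the proof of the master tail bound (eq. (63)): for every real s ≥ 0, every real θ > 0, and every positive integer K, (θ·s + 1)^K − 1 ≤ max(θ, θ^K) · ((s + 1)^K − 1). -/
/-- Scalar inequality used in the proof of the master tail bound (eq. (63)). -/
theorem scalar_ineq_master_bound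
    (s θ : ℝ) (hs : 0 ≤ s) (hθ : 0 < θ) (K : ℕ) (hK : 0 < K) :
    (θ * s + 1) ^ K - 1 ≤ max θ (θ ^ K) * ((s + 1) ^ K - 1) := by
  have key : ∀ x : ℝ, (x + 1) ^ K - 1
      = ∑ k ∈ Finset.range K, x ^ (k + 1) * (K.choose (k + 1) : ℝ) := by
    intro x
    rw [add_pow, Finset.sum_range_succ']
    simp
  rw [key, key, Finset.mul_sum]
  apply Finset.sum_le_sum
  intro k hk
  have hk' : k + 1 ≤ K := Finset.mem_range.mp hk
  have h : θ ^ (k + 1) ≤ max θ (θ ^ K) := by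
    rcases le_total θ 1 with h1 | h1
    · exact le_max_of_le_left (pow_le_of_le_one hθ.le h1 (Nat.succ_ne_zero k))
    · exact le_max_of_le_right (pow_le_pow_right₀ h1 hk')
  rw [mul_pow, mul_assoc]
  exact mul_le_mul_of_nonneg_right h (by positivity)
end

section
/- Domination property of the auxiliary function g_1 (eq. (9)): for every positive integer K and every real θ > 0, e^{K·θ} − K·θ + α1(K) ≥ max(θ, θ^K), where α1(K) = ((K+1)/K)·(log((K+1)/K) − 1). -/
theorem aux_pow (θ a : ℝ) (hθ : 1 ≤ θ) (ha : θ + 3/2 ≤ a) (K : ℕ) (hK : 2 ≤ K) :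
    θ ^ K + 3/2 * (K : ℝ) * θ ≤ a ^ K := by
  induction K, hK using Nat.le_induction with
  | base => push_cast; nlinarith
  | succ n hn ih =>
    have h1 : θ ≤ θ ^ n := le_self_pow₀ hθ (by omega)
    have hn0 : (0:ℝ) ≤ n := Nat.cast_nonneg n
    have h2 : (θ + 3/2) * (θ ^ n + 3/2 * (n : ℝ) * θ) ≤ a * a ^ n := by
      apply mul_le_mul ha ih (by positivity) (by linarith)
    have h3 : 0 ≤ (θ + 1/2) * (3/2 * (n : ℝ) * θ) := by positivity
    rw [pow_succ, pow_succ]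
    push_cast
    nlinarith

/-- Domination property of the auxiliary function `g₁` (eq. (9)):
`e^{Kθ} - Kθ + α₁(K) ≥ max (θ, θ^K)` where
`α₁(K) = ((K+1)/K) * (log ((K+1)/K) - 1)`. -/
theorem g1_dominates_max
    (K : ℕ) (hK : 0 < K) (θ : ℝ) (hθ : 0 < θ) :
    max θ (θ ^ K) ≤
      Real.exp ((K : ℝ) * θ) - (K : ℝ) * θ +
        ((K + 1 : ℝ) / K) * (Real.log ((K + 1 : ℝ) / K) - 1) := by
  have hK' : (0:ℝ) < K := by exact_mod_cast hK
  have hcK : ((K + 1 : ℝ) / K) * (K * θ) = K * θ + θ := by field_simp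
  have hc : (0:ℝ) < (K + 1 : ℝ) / K := by positivity
  generalize (K + 1 : ℝ) / K = c at hcK hc ⊢
  have key : ∀ x : ℝ, c * (x - Real.log c + 1) ≤ Real.exp x := by
    intro x
    have h := mul_le_mul_of_nonneg_left (Real.add_one_le_exp (x - Real.log c)) hc.le
    rwa [Real.exp_sub, Real.exp_log hc, mul_div_cancel₀ _ hc.ne'] at h
  have h1 : θ ≤ Real.exp (K * θ) - K * θ + c * (Real.log c - 1) := by
    have := key (K * θ)
    nlinarith
  apply max_le h1
  rcases le_total θ 1 with h | h
  · exact (pow_le_of_le_one hθ.le h hK.ne').trans h1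
  rcases Nat.lt_or_ge K 2 with h2 | h2
  · have : K = 1 := by omega
    subst this
    simpa using h1
  have h0 := key 0
  rw [Real.exp_zero] at h0
  have ha : θ + 3/2 ≤ Real.exp θ := by
    have := Real.quadratic_le_exp_of_nonneg hθ.le
    nlinarith
  have h3 := aux_pow θ _ h ha K h2
  rw [← Real.exp_nat_mul] at h3
  have h4 : (2:ℝ) ≤ K := by exact_mod_cast h2
  nlinarith
end

section
/- Domination property of the auxiliary function g_3 (used in the remark after Theorem 5): for every positive integer K and every real θ > 0, θ^{K+1} + α3(K) ≥ max(θ, θ^K), where α3(K) = (K/(K+1)) · (1/(K+1))^{1/K}. -/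
/-- Domination property of the auxiliary function `g₃`:
`θ^{K+1} + α₃(K) ≥ max (θ, θ^K)` where
`α₃(K) = (K/(K+1)) * (1/(K+1))^{1/K}`. -/
theorem g3_dominates_max
    (K : ℕ) (hK : 0 < K) (θ : ℝ) (hθ : 0 < θ) :
    max θ (θ ^ K) ≤
      θ ^ (K + 1) + ((K : ℝ) / (K + 1)) * ((1 : ℝ) / (K + 1)) ^ ((1 : ℝ) / K) := by
  have hK1 : (0 : ℝ) < K + 1 := by positivity
  have hc : (0 : ℝ) < ((1 : ℝ) / (K + 1)) ^ ((1 : ℝ) / K) := by positivity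
  have hcK : (((1 : ℝ) / (K + 1)) ^ ((1 : ℝ) / K)) ^ K = 1 / (K + 1) := by
    rw [one_div (K : ℝ)]
    exact Real.rpow_inv_natCast_pow (by positivity) hK.ne'
  generalize ((1 : ℝ) / (K + 1)) ^ ((1 : ℝ) / K) = c at hc hcK ⊢
  have h1 : θ ≤ θ ^ (K + 1) + ((K : ℝ) / (K + 1)) * c := by
    have hb := one_add_mul_sub_le_pow (a := θ / c)
      (by have : 0 < θ / c := by positivity
          linarith) (K + 1)
    have e : θ ^ (K + 1) = c / (K + 1) * (θ / c) ^ (K + 1) := by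
      have : c ^ (K + 1) = c / (K + 1) := by rw [pow_succ, hcK]; ring
      rw [← this, ← mul_pow, mul_div_cancel₀ _ hc.ne']
    have h2 := mul_le_mul_of_nonneg_left hb (show 0 ≤ c / ((K : ℝ) + 1) by positivity)
    rw [← e] at h2
    have e2 : c / ((K : ℝ) + 1) * (1 + ((K + 1 : ℕ) : ℝ) * (θ / c - 1))
        = θ - (K : ℝ) / (K + 1) * c := by
      push_cast
      field_simp
      ring
    linarith
  refine max_le h1 ?_
  rcases le_total θ 1 with h | h
  · exact (pow_le_of_le_one hθ.le h hK.ne').trans h1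
  · have := pow_le_pow_right₀ h (Nat.le_succ K)
    have h3 : 0 ≤ (K : ℝ) / (K + 1) * c := by positivity
    simp only [Nat.succ_eq_add_one] at this
    linarith
end
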